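/- There exists a unitary operator (linear isometric isomorphism) Π : H → ℓ²(ℕ, W) such that: (i) for every x ∈ H, (Π(Vx))(0) = 0 and (Π(Vx))(m+1) = (Πx)(m) for all m ∈ ℕ (i.e., Π intertwines V with the unilateral shift on ℓ²(ℕ, W)); and (ii) for every i ∈ {1,…,n}, every x ∈ H and every m ∈ ℕ, (Π(V_i x))(0) = U_i(P_{W̃_i}((Πx)(0))) and (Π(V_i x))(m+1) = U_i(P_{W̃_i}((Πx)(m+1))) + U_i((Πx)(m) − P_{W̃_i}((Πx)(m))). In other words, Π carries each V_i to the multiplication operator M_{Φ_i} on H²_W(𝔻) ≅ ℓ²(ℕ, W) with symbol Φ_i(z) = U_i(P_{W̃_i} + z P⊥_{W̃_i}); in particular (V_1,…,V_n) is unitarily equivalent to (M_{Φ_1},…,M_{Φ_n}). -/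

import Mathlib

open ContinuousLinearMap Filter Finset

/-- Product of the commuting operators `V i` over a finite index set `s`. -/
noncomputable def opProd {H : Type*} [NormedAddCommGroup H] [InnerProductSpace ℂ H]
    {n : ℕ} (V : Fin n → H →L[ℂ] H) (hcomm : ∀ i j, Commute (V i) (V j))
    (s : Finset (Fin n)) : H →L[ℂ] H :=
  s.noncommProd V fun a _ b _ _ => hcomm a b

/-- The wandering subspace `ker ((∏_{i ∈ s} V i)^*)`. -/
noncomputable def wSub {H : Type*} [NormedAddCommGroup H] [InnerProductSpace ℂ H] [CompleteSpace H]
    {n : ℕ} (V : Fin n → H →L[ℂ] H) (hcomm : ∀ i j, Commute (V i) (V j))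
    (s : Finset (Fin n)) : Submodule ℂ H :=
  LinearMap.ker (ContinuousLinearMap.adjoint (opProd V hcomm s)).toLinearMap

/-- The orthogonal projection of `H` onto `wSub V hcomm s`, as an operator on `H`. -/
noncomputable def wProj {H : Type*} [NormedAddCommGroup H] [InnerProductSpace ℂ H] [CompleteSpace H]
    {n : ℕ} (V : Fin n → H →L[ℂ] H) (hcomm : ∀ i j, Commute (V i) (V j))
    (s : Finset (Fin n)) : H →L[ℂ] H :=
  haveI : CompleteSpace (wSub V hcomm s) :=
    (ContinuousLinearMap.isClosed_ker _).completeSpace_coe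
  (wSub V hcomm s).subtypeL ∘L Submodule.orthogonalProjectionOnto (wSub V hcomm s)

/-- The operator `U_i = P_W ∘ V_i + Ṽ_i^*`, which restricts to a unitary on `W`. -/
noncomputable def Uop {H : Type*} [NormedAddCommGroup H] [InnerProductSpace ℂ H] [CompleteSpace H]
    {n : ℕ} (V : Fin n → H →L[ℂ] H) (hcomm : ∀ i j, Commute (V i) (V j))
    (i : Fin n) : H →L[ℂ] H :=
  (wProj V hcomm Finset.univ) ∘L V i
    + ContinuousLinearMap.adjoint (opProd V hcomm (Finset.univ.erase i))

section WoldDecomposition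

variable {H : Type*} [NormedAddCommGroup H] [InnerProductSpace ℂ H] [CompleteSpace H]

theorem adjoint_apply_self_of_isometry {S : H →L[ℂ] H} (hS : ∀ x, ‖S x‖ = ‖x‖) (x : H) :
    adjoint S (S x) = x := by
  have h := (ContinuousLinearMap.norm_map_iff_adjoint_comp_self S).1 hS
  simpa using congrArg (fun T : H →L[ℂ] H => T x) h

theorem norm_sq_sub_apply_adjoint {S : H →L[ℂ] H} (hS : ∀ x, ‖S x‖ = ‖x‖) (y : H) :
    ‖y - S (adjoint S y)‖ ^ 2 = ‖y‖ ^ 2 - ‖adjoint S y‖ ^ 2 := by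
  have h : inner ℂ y (S (adjoint S y)) = ((‖adjoint S y‖ ^ 2 : ℝ) : ℂ) := by
    rw [← adjoint_inner_left, inner_self_eq_norm_sq_to_K]
    norm_cast
  rw [@norm_sub_sq ℂ, h, hS]
  simp only [RCLike.re_to_complex, Complex.ofReal_re]
  ring

/-- The `m`-th Wold coefficient `(1 - S S^*) (S^*)^m x` of `x`. -/
noncomputable def woldCoeff (S : H →L[ℂ] H) (x : H) (m : ℕ) : H :=
  (adjoint S ^ m) x - S (adjoint S ((adjoint S ^ m) x))

theorem woldCoeff_mem_ker {S : H →L[ℂ] H} (hS : ∀ x, ‖S x‖ = ‖x‖) (x : H) (m : ℕ) :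
    woldCoeff S x m ∈ LinearMap.ker (adjoint S).toLinearMap := by
  simp [woldCoeff, adjoint_apply_self_of_isometry hS]

theorem hasSum_norm_sq_woldCoeff {S : H →L[ℂ] H} (hS : ∀ x, ‖S x‖ = ‖x‖)
    (hshift : ∀ x, Tendsto (fun m : ℕ => (adjoint S ^ m) x) atTop (nhds 0)) (x : H) :
    HasSum (fun m => ‖woldCoeff S x m‖ ^ 2) (‖x‖ ^ 2) := by
  rw [hasSum_iff_tendsto_nat_of_nonneg (fun _ => by positivity)]
  have hsum : ∀ N, ∑ m ∈ range N, ‖woldCoeff S x m‖ ^ 2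
      = ‖x‖ ^ 2 - ‖(adjoint S ^ N) x‖ ^ 2 := by
    intro N
    induction N with
    | zero => simp
    | succ N ih =>
      rw [sum_range_succ, ih, woldCoeff, norm_sq_sub_apply_adjoint hS,
        pow_succ' (adjoint S), mul_apply_eq_comp]
      ring
  simp only [hsum]
  simpa using ((hshift x).norm.pow 2).const_sub (‖x‖ ^ 2)

/-- The Wold map `x ↦ ((1 - S S^*) (S^*)^m x)_m` of a shift `S`, as a linear isometry. -/
noncomputable def woldIsometry (S : H →L[ℂ] H) (hS : ∀ x, ‖S x‖ = ‖x‖)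
    (hshift : ∀ x, Tendsto (fun m : ℕ => (adjoint S ^ m) x) atTop (nhds 0)) :
    H →ₗᵢ[ℂ] lp (fun _ : ℕ => ↥(LinearMap.ker (adjoint S).toLinearMap)) 2 where
  toFun x := ⟨fun m => ⟨woldCoeff S x m, woldCoeff_mem_ker hS x m⟩, by
    refine memℓp_gen ?_
    simpa using (hasSum_norm_sq_woldCoeff hS hshift x).summable⟩
  map_add' x y := by
    ext m
    simp only [woldCoeff, map_add, lp.coeFn_add, Pi.add_apply, Submodule.coe_add]
    abel
  map_smul' c x := by
    ext m
    simp [woldCoeff, smul_sub]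
  norm_map' x := by
    have h := lp.norm_rpow_eq_tsum (p := 2) (by norm_num)
      (⟨fun m => ⟨woldCoeff S x m, woldCoeff_mem_ker hS x m⟩, by
        refine memℓp_gen ?_
        simpa using (hasSum_norm_sq_woldCoeff hS hshift x).summable⟩ :
        lp (fun _ : ℕ => ↥(LinearMap.ker (adjoint S).toLinearMap)) 2)
    have h2 := (hasSum_norm_sq_woldCoeff hS hshift x).tsum_eq
    simp only [ENNReal.toReal_ofNat, Real.rpow_ofNat, Submodule.coe_norm] at h
    rw [h2] at h
    exact (pow_left_inj₀ (norm_nonneg _) (norm_nonneg _) two_ne_zero).1 h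

theorem coe_woldIsometry_apply (S : H →L[ℂ] H) (hS : ∀ x, ‖S x‖ = ‖x‖)
    (hshift : ∀ x, Tendsto (fun m : ℕ => (adjoint S ^ m) x) atTop (nhds 0)) (x : H) (m : ℕ) :
    (woldIsometry S hS hshift x m : H) = woldCoeff S x m := rfl

theorem woldCoeff_apply_zero {S : H →L[ℂ] H} (hS : ∀ x, ‖S x‖ = ‖x‖) (x : H) :
    woldCoeff S (S x) 0 = 0 := by
  simp [woldCoeff, adjoint_apply_self_of_isometry hS]

theorem woldCoeff_apply_succ {S : H →L[ℂ] H} (hS : ∀ x, ‖S x‖ = ‖x‖) (x : H) (m : ℕ) :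
    woldCoeff S (S x) (m + 1) = woldCoeff S x m := by
  simp [woldCoeff, pow_succ, adjoint_apply_self_of_isometry hS]

theorem woldCoeff_pow_apply {S : H →L[ℂ] H} (hS : ∀ x, ‖S x‖ = ‖x‖) {w : H}
    (hw : adjoint S w = 0) (k m : ℕ) :
    woldCoeff S ((S ^ k) w) m = if m = k then w else 0 := by
  induction k generalizing m with
  | zero =>
    cases m with
    | zero => simp [woldCoeff, hw]
    | succ m => simp [woldCoeff, pow_succ, hw]
  | succ k ih =>
    rw [pow_succ', mul_apply_eq_comp]
    cases m with
    | zero => simp [woldCoeff_apply_zero hS]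
    | succ m => simp only [woldCoeff_apply_succ hS, ih, add_left_inj]

theorem woldIsometry_surjective (S : H →L[ℂ] H) (hS : ∀ x, ‖S x‖ = ‖x‖)
    (hshift : ∀ x, Tendsto (fun m : ℕ => (adjoint S ^ m) x) atTop (nhds 0)) :
    Function.Surjective (woldIsometry S hS hshift) := by
  intro f
  have hclosed : IsClosed (Set.range (woldIsometry S hS hshift)) :=
    (woldIsometry S hS hshift).isometry.isClosedEmbedding.isClosed_range
  have hsingle : ∀ k, woldIsometry S hS hshift ((S ^ k) (f k : H)) = lp.single 2 k (f k) := by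
    intro k
    ext m
    rw [coe_woldIsometry_apply, woldCoeff_pow_apply hS (f k).2]
    by_cases h : m = k
    · subst h; simp
    · simp [h]
  refine hclosed.mem_of_tendsto (lp.hasSum_single (by norm_num) f) (Eventually.of_forall ?_)
  intro s
  exact ⟨∑ k ∈ s, (S ^ k) (f k : H), by simp only [map_sum, hsingle]⟩

end WoldDecomposition

section Factorization

variable {H : Type*} [NormedAddCommGroup H] [InnerProductSpace ℂ H] [CompleteSpace H]
  {A B S : H →L[ℂ] H}

theorem adjoint_apply_factor (hA : ∀ x, ‖A x‖ = ‖x‖) (hAB : S = A * B) (y : H) :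
    adjoint S (A y) = adjoint B y := by
  rw [hAB, ContinuousLinearMap.mul_def, adjoint_comp, comp_apply, adjoint_apply_self_of_isometry hA]

theorem adjoint_pow_apply_factor (hA : ∀ x, ‖A x‖ = ‖x‖) (hAB : S = A * B) (hBA : S = B * A)
    (m : ℕ) (y : H) : (adjoint S ^ (m + 1)) (A y) = adjoint B ((adjoint S ^ m) y) := by
  have hcomm : Commute (adjoint S) (adjoint B) := by
    have h : S * B = B * S := by
      nth_rewrite 1 [hBA]
      rw [hAB, mul_assoc]
    have h' := congrArg adjoint h
    rw [ContinuousLinearMap.mul_def, ContinuousLinearMap.mul_def, adjoint_comp, adjoint_comp] at h'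
    exact h'.symm
  rw [pow_succ, mul_apply_eq_comp, adjoint_apply_factor hA hAB]
  exact congrArg (fun T : H →L[ℂ] H => T y) (hcomm.pow_left m).eq

variable {U P : H →L[ℂ] H}

theorem woldCoeff_factor_zero (hA : ∀ x, ‖A x‖ = ‖x‖) (hB : ∀ x, ‖B x‖ = ‖x‖)
    (hAB : S = A * B) (hBA : S = B * A)
    (hU : ∀ y, U y = A y - S (adjoint S (A y)) + adjoint B y)
    (hP : ∀ y, P y = y - B (adjoint B y)) (x : H) :
    woldCoeff S (A x) 0 = U (P (woldCoeff S x 0)) := by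
  have hABy : ∀ y, A (B y) = S y := fun y => by rw [hAB]; rfl
  have hBAy : ∀ y, B (A y) = S y := fun y => by rw [hBA]; rfl
  have hBS : ∀ y, adjoint B (S y) = A y := fun y => by
    rw [← hBAy, adjoint_apply_self_of_isometry hB]
  have hSS : ∀ y, adjoint S (S y) = y := fun y => by
    rw [← hABy, adjoint_apply_factor hA hAB, adjoint_apply_self_of_isometry hB]
  simp only [woldCoeff, hU, hP, map_sub, adjoint_apply_factor hA hAB, hBS, hSS, hBAy, hABy,
    adjoint_apply_self_of_isometry hB, pow_zero, one_apply_eq_self]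
  abel

theorem woldCoeff_factor_succ (hA : ∀ x, ‖A x‖ = ‖x‖) (hB : ∀ x, ‖B x‖ = ‖x‖)
    (hAB : S = A * B) (hBA : S = B * A)
    (hU : ∀ y, U y = A y - S (adjoint S (A y)) + adjoint B y)
    (hP : ∀ y, P y = y - B (adjoint B y)) (x : H) (m : ℕ) :
    woldCoeff S (A x) (m + 1)
      = U (P (woldCoeff S x (m + 1))) + U (woldCoeff S x m - P (woldCoeff S x m)) := by
  have hABy : ∀ y, A (B y) = S y := fun y => by rw [hAB]; rfl
  have hBAy : ∀ y, B (A y) = S y := fun y => by rw [hBA]; rfl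
  have hBS : ∀ y, adjoint B (S y) = A y := fun y => by
    rw [← hBAy, adjoint_apply_self_of_isometry hB]
  have hSB : ∀ y, adjoint S (adjoint B y) = adjoint B (adjoint S y) := fun y => by
    simpa [pow_succ, adjoint_apply_factor hA hAB] using adjoint_pow_apply_factor hA hAB hBA 1 y
  have hSS : ∀ y, adjoint S (S y) = y := fun y => by
    rw [← hABy, adjoint_apply_factor hA hAB, adjoint_apply_self_of_isometry hB]
  have hAS : ∀ y, A (S y) = S (A y) := fun y => by rw [← hBAy, hABy]
  have hsucc : (adjoint S ^ (m + 1)) x = adjoint S ((adjoint S ^ m) x) := by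
    rw [pow_succ']; rfl
  simp only [woldCoeff, hU, hP, map_sub, adjoint_pow_apply_factor hA hAB hBA, hsucc,
    adjoint_apply_factor hA hAB, hBS, hBAy, hABy, hSB, hSS, hAS,
    adjoint_apply_self_of_isometry hB]
  abel

end Factorization

section CommutingIsometries

variable {H : Type*} [NormedAddCommGroup H] [InnerProductSpace ℂ H] {n : ℕ}
  (V : Fin n → H →L[ℂ] H) (hcomm : ∀ i j, Commute (V i) (V j))

theorem norm_opProd_apply (hiso : ∀ i x, ‖V i x‖ = ‖x‖) (s : Finset (Fin n)) (x : H) :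
    ‖opProd V hcomm s x‖ = ‖x‖ := by
  induction s using Finset.induction_on with
  | empty => exact congrArg (fun T : H →L[ℂ] H => ‖T x‖) (noncommProd_empty V _)
  | insert a s ha ih =>
    have h : opProd V hcomm (insert a s) = V a * opProd V hcomm s :=
      noncommProd_insert_of_notMem s a V (fun a _ b _ _ => hcomm a b) ha
    rw [h, mul_apply_eq_comp, hiso, ih]

theorem opProd_univ_eq_mul_erase (i : Fin n) :
    opProd V hcomm univ = V i * opProd V hcomm (univ.erase i) :=
  (mul_noncommProd_erase _ (mem_univ i) V fun a _ b _ _ => hcomm a b).symm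

theorem opProd_univ_eq_erase_mul (i : Fin n) :
    opProd V hcomm univ = opProd V hcomm (univ.erase i) * V i :=
  (noncommProd_erase_mul _ (mem_univ i) V fun a _ b _ _ => hcomm a b).symm

theorem wProj_apply [CompleteSpace H] (hiso : ∀ i x, ‖V i x‖ = ‖x‖) (s : Finset (Fin n)) (x : H) :
    wProj V hcomm s x = x - opProd V hcomm s (adjoint (opProd V hcomm s) x) := by
  have hS := norm_opProd_apply V hcomm hiso s
  have : CompleteSpace (wSub V hcomm s) :=
    (ContinuousLinearMap.isClosed_ker _).completeSpace_coe
  change (wSub V hcomm s).starProjection x = _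
  refine Submodule.eq_starProjection_of_mem_of_inner_eq_zero ?_ ?_
  · simp [wSub, adjoint_apply_self_of_isometry hS]
  · intro w hw
    have hw' : adjoint (opProd V hcomm s) w = 0 := hw
    rw [sub_sub_cancel, ← adjoint_inner_right, hw', inner_zero_right]

end CommutingIsometries

/-- Wold–von Neumann decomposition carrying `(V_1,…,V_n)` to the model `n`-isometry
`(M_{Φ_1},…,M_{Φ_n})` with `Φ_i(z) = U_i(P_{W̃_i} + z P⊥_{W̃_i})` on `H²_W(𝔻) ≅ ℓ²(ℕ, W)`. -/
theorem stmt10 {H : Type*} [NormedAddCommGroup H] [InnerProductSpace ℂ H] [CompleteSpace H]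
    {n : ℕ} (hn : 2 ≤ n) (V : Fin n → H →L[ℂ] H)
    (hiso : ∀ i x, ‖V i x‖ = ‖x‖) (hcomm : ∀ i j, Commute (V i) (V j))
    (hshift : ∀ x : H,
      Tendsto (fun m : ℕ => ((ContinuousLinearMap.adjoint (opProd V hcomm Finset.univ)) ^ m) x)
        atTop (nhds 0)) :
    ∃ Wold : H ≃ₗᵢ[ℂ] lp (fun _ : ℕ => ↥(wSub V hcomm Finset.univ)) 2,
      (∀ x : H,
        Wold (opProd V hcomm Finset.univ x) 0 = 0 ∧
        ∀ m : ℕ, Wold (opProd V hcomm Finset.univ x) (m + 1) = Wold x m) ∧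
      (∀ (i : Fin n) (x : H),
        ((Wold (V i x) 0 : H)
            = Uop V hcomm i (wProj V hcomm (Finset.univ.erase i) (Wold x 0 : H))) ∧
        ∀ m : ℕ,
          ((Wold (V i x) (m + 1) : H)
            = Uop V hcomm i (wProj V hcomm (Finset.univ.erase i) (Wold x (m + 1) : H))
              + Uop V hcomm i
                  ((Wold x m : H) - wProj V hcomm (Finset.univ.erase i) (Wold x m : H)))) := by
  have hS := norm_opProd_apply V hcomm hiso univ
  have hU : ∀ i y, Uop V hcomm i y = V i y
      - opProd V hcomm univ (adjoint (opProd V hcomm univ) (V i y))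
      + adjoint (opProd V hcomm (univ.erase i)) y := fun i y => by
    rw [← wProj_apply V hcomm hiso]; rfl
  refine ⟨LinearIsometryEquiv.ofSurjective (woldIsometry _ hS hshift)
    (woldIsometry_surjective _ hS hshift), fun x => ⟨?_, fun m => ?_⟩,
    fun i x => ⟨?_, fun m => ?_⟩⟩
  · exact Subtype.ext (woldCoeff_apply_zero hS x)
  · exact Subtype.ext (woldCoeff_apply_succ hS x m)
  · exact woldCoeff_factor_zero (hiso i) (norm_opProd_apply V hcomm hiso _)
      (opProd_univ_eq_mul_erase V hcomm i) (opProd_univ_eq_erase_mul V hcomm i) (hU i)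
      (wProj_apply V hcomm hiso _) x
  · exact woldCoeff_factor_succ (hiso i) (norm_opProd_apply V hcomm hiso _)
      (opProd_univ_eq_mul_erase V hcomm i) (opProd_univ_eq_erase_mul V hcomm i) (hU i)
      (wProj_apply V hcomm hiso _) x m
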